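/- There is a universal constant C > 0 such that the following holds. Let G=(V,E) be a finite connected graph with m edges, minimum degree d and relaxation time t_rel, let x be any vertex, let K ≥ 1, and let 𝓘_t^{(1)},…,𝓘_t^{(K)} be independent copies of the weighted number of intersections 𝓘_t of two independent lazy random walks of length t started at x. Define the estimator m̂_t = t² / ((2/K)·Σ_{k=1}^K 𝓘_t^{(k)}). Then for every t ≥ 4√3·t_rel^{3/4}·sqrt(m/d), P_x(|m̂_t/m − 1| > 1/2) ≤ C/K. -/

import Mathlib

open Finset
open scoped Classical BigOperators

/-- The transition matrix of the lazy random walk on a finite graph `G`. -/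
noncomputable def lazyP {V : Type} [Fintype V] (G : SimpleGraph V) : Matrix V V ℝ :=
  fun u v =>
    if u = v then 1 / 2
    else if G.Adj u v then 1 / (2 * (G.degree u : ℝ)) else 0

/-- The number of edges of `G`. -/
noncomputable def numEdges {V : Type} [Fintype V] (G : SimpleGraph V) : ℕ :=
  G.edgeFinset.card

/-- The stationary distribution `π(u) = deg(u) / (2m)` of the lazy random walk. -/
noncomputable def statDist {V : Type} [Fintype V] (G : SimpleGraph V) (u : V) : ℝ :=
  (G.degree u : ℝ) / (2 * (numEdges G : ℝ))

/-- The second-largest eigenvalue `λ₂` of a reversible transition matrix: the supremum of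
the (real) eigenvalues different from `1`. -/
noncomputable def secondEig {V : Type} [Fintype V] (P : Matrix V V ℝ) : ℝ :=
  sSup {r : ℝ | r ≠ 1 ∧ ∃ f : V → ℝ, f ≠ 0 ∧ P.mulVec f = r • f}

/-- The relaxation time `t_rel = ⌈1 / (1 - λ₂)⌉`. -/
noncomputable def relTime {V : Type} [Fintype V] (P : Matrix V V ℝ) : ℕ :=
  ⌈1 / (1 - secondEig P)⌉₊

/-- The uniform mixing time of the lazy random walk on `G`. -/
noncomputable def unifTime {V : Type} [Fintype V] (G : SimpleGraph V) : ℕ :=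
  sInf {t : ℕ | ∀ x y : V, |(lazyP G ^ t) x y / statDist G y - 1| ≤ 1 / 4}

/-- The Green's function `g_t(x, u) = ∑_{i<t} P^i(x, u)`. -/
noncomputable def green {V : Type} [Fintype V] (P : Matrix V V ℝ) (t : ℕ) (x u : V) : ℝ :=
  ∑ i ∈ Finset.range t, (P ^ i) x u

/-- The value of a finite trajectory at a natural number index (junk beyond the horizon). -/
noncomputable def traj {V : Type} [Nonempty V] {t : ℕ} (p : Fin t → V) (i : ℕ) : V :=
  if h : i < t then p ⟨i, h⟩ else Classical.arbitrary V

/-- The probability that the chain `P` started at `x` follows the length-`t` trajectory `p`. -/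
noncomputable def pathWeight {V : Type} [Fintype V] [Nonempty V] (P : Matrix V V ℝ)
    (x : V) (t : ℕ) (p : Fin t → V) : ℝ :=
  (if traj p 0 = x then 1 else 0) *
    ∏ i ∈ Finset.range (t - 1), P (traj p i) (traj p (i + 1))

/-- Expectation of a functional of two independent length-`t` walks started at `x` and `y`. -/
noncomputable def E2 {V : Type} [Fintype V] [Nonempty V] (P : Matrix V V ℝ) (x y : V)
    (t : ℕ) (F : (Fin t → V) → (Fin t → V) → ℝ) : ℝ :=
  ∑ p : Fin t → V, ∑ q : Fin t → V, pathWeight P x t p * pathWeight P y t q * F p q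

/-- Expectation of a functional of three independent length-`t` walks started at `x`. -/
noncomputable def E3 {V : Type} [Fintype V] [Nonempty V] (P : Matrix V V ℝ) (x : V)
    (t : ℕ) (F : (Fin t → V) → (Fin t → V) → (Fin t → V) → ℝ) : ℝ :=
  ∑ p : Fin t → V, ∑ q : Fin t → V, ∑ r : Fin t → V,
    pathWeight P x t p * pathWeight P x t q * pathWeight P x t r * F p q r

/-- Expectation of a functional of `2K` independent length-`t` walks
(`K` pairs) started at `x`. -/
noncomputable def EK {V : Type} [Fintype V] [Nonempty V] (P : Matrix V V ℝ) (x : V)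
    (t K : ℕ) (F : (Fin K → Fin t → V) → (Fin K → Fin t → V) → ℝ) : ℝ :=
  ∑ X : Fin K → Fin t → V, ∑ Y : Fin K → Fin t → V,
    (∏ k, pathWeight P x t (X k)) * (∏ k, pathWeight P x t (Y k)) * F X Y

/-- Expectation of a functional of `K` independent length-`t` walks started at `x`. -/
noncomputable def EKone {V : Type} [Fintype V] [Nonempty V] (P : Matrix V V ℝ) (x : V)
    (t K : ℕ) (F : (Fin K → Fin t → V) → ℝ) : ℝ :=
  ∑ X : Fin K → Fin t → V, (∏ k, pathWeight P x t (X k)) * F X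

/-- The weighted number of intersections of two trajectories over the time window `[a, b)`:
`∑_{i,j=a}^{b-1} (1 / deg(p_i)) 1{p_i = q_j}`. -/
noncomputable def wInterIco {V : Type} [Fintype V] [Nonempty V] (G : SimpleGraph V)
    (a b : ℕ) {t : ℕ} (p q : Fin t → V) : ℝ :=
  ∑ i ∈ Finset.Ico a b, ∑ j ∈ Finset.Ico a b,
    if traj p i = traj q j then 1 / (G.degree (traj p i) : ℝ) else 0

/-- The weighted number of intersections `𝓘_t` of two trajectories, up to time `t - 1`. -/
noncomputable def wInter {V : Type} [Fintype V] [Nonempty V] (G : SimpleGraph V)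
    {t : ℕ} (p q : Fin t → V) : ℝ :=
  wInterIco G 0 t p q

/-- The (unweighted) number of intersections `I_t` of two trajectories, up to time `t - 1`. -/
noncomputable def nInter {V : Type} [Nonempty V] {t : ℕ} (p q : Fin t → V) : ℝ :=
  ∑ i ∈ Finset.range t, ∑ j ∈ Finset.range t,
    if traj p i = traj q j then (1 : ℝ) else 0

/-- `E_{x,y}[𝓘_t]`: expected weighted number of intersections of two independent lazy random
walks started at `x` and `y`. -/
noncomputable def EIxy {V : Type} [Fintype V] [Nonempty V] (G : SimpleGraph V)
    (x y : V) (t : ℕ) : ℝ :=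
  E2 (lazyP G) x y t fun p q => wInter G p q

/-- `E_x[𝓘_t]`. -/
noncomputable def EI {V : Type} [Fintype V] [Nonempty V] (G : SimpleGraph V)
    (x : V) (t : ℕ) : ℝ :=
  EIxy G x x t

/-- `E_x[𝓘_t²]`. -/
noncomputable def EIsq {V : Type} [Fintype V] [Nonempty V] (G : SimpleGraph V)
    (x : V) (t : ℕ) : ℝ :=
  E2 (lazyP G) x x t fun p q => (wInter G p q) ^ 2

/-- `E_x[𝓙_t]`: expected weighted number of intersections over the window
`[t_unif, t_unif + t - 1]`. -/
noncomputable def EJ {V : Type} [Fintype V] [Nonempty V] (G : SimpleGraph V)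
    (x : V) (t : ℕ) : ℝ :=
  E2 (lazyP G) x x (unifTime G + t) fun p q =>
    wInterIco G (unifTime G) (unifTime G + t) p q

/-- `E_x[𝓙_t²]`. -/
noncomputable def EJsq {V : Type} [Fintype V] [Nonempty V] (G : SimpleGraph V)
    (x : V) (t : ℕ) : ℝ :=
  E2 (lazyP G) x x (unifTime G + t) fun p q =>
    (wInterIco G (unifTime G) (unifTime G + t) p q) ^ 2

/-- `E_x[ℒ_t]`: expected weighted number of intersections between times `t` and `2t - 1`. -/
noncomputable def EL {V : Type} [Fintype V] [Nonempty V] (G : SimpleGraph V)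
    (x : V) (t : ℕ) : ℝ :=
  E2 (lazyP G) x x (2 * t) fun p q => wInterIco G t (2 * t) p q

/-- `E_x[ℒ_t²]`. -/
noncomputable def ELsq {V : Type} [Fintype V] [Nonempty V] (G : SimpleGraph V)
    (x : V) (t : ℕ) : ℝ :=
  E2 (lazyP G) x x (2 * t) fun p q => (wInterIco G t (2 * t) p q) ^ 2

/-- `E_x[ℒ_t^{(X,Y)} · ℒ_t^{(X,Z)}]` for three independent walks `X, Y, Z` started at `x`. -/
noncomputable def ELprod {V : Type} [Fintype V] [Nonempty V] (G : SimpleGraph V)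
    (x : V) (t : ℕ) : ℝ :=
  E3 (lazyP G) x (2 * t) fun p q r =>
    wInterIco G t (2 * t) p q * wInterIco G t (2 * t) p r

/-- The inner product `⟨f, g⟩_π = ∑_x π(x) f(x) g(x)`. -/
noncomputable def ipi {X : Type} [Fintype X] (π : X → ℝ) (f g : X → ℝ) : ℝ :=
  ∑ x, π x * f x * g x

/-- The position of the first occurrence of `s i` in the finite sequence `s`. -/
noncomputable def firstOcc {V : Type} {N : ℕ} (s : Fin N → V) (i : Fin N) : ℕ :=
  sInf {j : ℕ | ∃ h : j < N, s ⟨j, h⟩ = s i}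

/-- The index (rank) of first occurrence of `s i` among the distinct values of `s`,
in order of first appearance. -/
noncomputable def rankSeq {V : Type} {N : ℕ} (s : Fin N → V) (i : Fin N) : ℕ :=
  ((Finset.univ.image fun j : Fin N => firstOcc s j).filter
    fun a => a ≤ firstOcc s i).card

/-- The profile `Φ` of a finite sequence of vertices: the sequence of ranks of first
occurrence together with the sequence of degrees. -/
noncomputable def profileOf {V : Type} [Fintype V] (G : SimpleGraph V) {N : ℕ}
    (s : Fin N → V) : Fin N → ℕ × ℕ :=
  fun i => (rankSeq s i, G.degree (s i))

/-- Concatenation of `K` trajectories of length `t` into one sequence of length `K * t`. -/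
noncomputable def concatW {V : Type} [Nonempty V] {K t : ℕ} (X : Fin K → Fin t → V)
    (i : Fin (K * t)) : V :=
  if h : 0 < t then
    X ⟨i.1 / t, (Nat.div_lt_iff_lt_mul h).2 i.2⟩ ⟨i.1 % t, Nat.mod_lt _ h⟩
  else Classical.arbitrary V


section helpers

lemma aux_lazy_apply {V : Type} [Fintype V] (G : SimpleGraph V) (hd : ∀ u, 0 < G.degree u)
    (u v : V) : (G.degree u : ℝ) * lazyP G u v =
      (if u = v then (G.degree u : ℝ) / 2 else 0) + (if G.Adj u v then 1 / 2 else 0) := by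
  have h : (0 : ℝ) < G.degree u := by exact_mod_cast hd u
  unfold lazyP
  by_cases huv : u = v
  · subst huv; simp; ring
  · by_cases ha : G.Adj u v
    · simp [huv, ha]; field_simp
    · simp [huv, ha]

lemma aux_rev {V : Type} [Fintype V] (G : SimpleGraph V) (hd : ∀ u, 0 < G.degree u)
    (u v : V) : (G.degree u : ℝ) * lazyP G u v = (G.degree v : ℝ) * lazyP G v u := by
  rw [aux_lazy_apply G hd, aux_lazy_apply G hd]
  by_cases huv : u = v
  · subst huv; rfl
  · simp [huv, Ne.symm huv, G.adj_comm]

lemma aux_pow_rev {V : Type} [Fintype V] (G : SimpleGraph V) (hd : ∀ u, 0 < G.degree u)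
    (n : ℕ) : ∀ u v : V, (G.degree u : ℝ) * (lazyP G ^ n) u v
      = (G.degree v : ℝ) * (lazyP G ^ n) v u := by
  induction n with
  | zero =>
    intro u v
    by_cases huv : u = v
    · subst huv; rfl
    · simp [huv, Ne.symm huv]
  | succ n ih =>
    intro u v
    rw [pow_succ, Matrix.mul_apply, ← pow_succ, pow_succ', Matrix.mul_apply, mul_sum, mul_sum]
    refine Finset.sum_congr rfl fun k _ => ?_
    rw [← mul_assoc, ih u k, mul_comm (G.degree k : ℝ), mul_assoc, aux_rev G hd k v]
    ring

lemma aux_nonneg {V : Type} [Fintype V] (G : SimpleGraph V) (u v : V) : 0 ≤ lazyP G u v := by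
  unfold lazyP; split_ifs <;> positivity

lemma aux_pow_nonneg {V : Type} [Fintype V] (G : SimpleGraph V) (n : ℕ) :
    ∀ u v : V, 0 ≤ (lazyP G ^ n) u v := by
  induction n with
  | zero => intro u v; simp only [pow_zero, Matrix.one_apply]; split_ifs <;> norm_num
  | succ n ih =>
    intro u v
    rw [pow_succ, Matrix.mul_apply]
    exact Finset.sum_nonneg fun k _ => mul_nonneg (ih u k) (aux_nonneg G k v)

/-- `w(u) (Pf)(u)` -/
lemma aux_mulVec {V : Type} [Fintype V] (G : SimpleGraph V) (hd : ∀ u, 0 < G.degree u)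
    (f : V → ℝ) (u : V) : (G.degree u : ℝ) * (lazyP G).mulVec f u =
      (G.degree u : ℝ) / 2 * f u + (1 / 2) * ∑ v, if G.Adj u v then f v else 0 := by
  simp only [Matrix.mulVec, dotProduct]
  rw [mul_sum, mul_sum]
  simp_rw [← mul_assoc, aux_lazy_apply G hd, add_mul, Finset.sum_add_distrib]
  simp

lemma aux_adj_sum {V : Type} [Fintype V] (G : SimpleGraph V) (u : V) (c : ℝ) :
    (∑ v, if G.Adj u v then c else 0) = (G.degree u : ℝ) * c := by
  rw [← Finset.sum_filter, Finset.sum_const, nsmul_eq_mul]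
  congr 2
  rw [← G.card_neighborFinset_eq_degree, G.neighborFinset_eq_filter]

lemma aux_row {V : Type} [Fintype V] (G : SimpleGraph V) (hd : ∀ u, 0 < G.degree u)
    (u : V) : ∑ v, lazyP G u v = 1 := by
  have h : (0 : ℝ) < G.degree u := by exact_mod_cast hd u
  have := aux_mulVec G hd (fun _ => 1) u
  rw [aux_adj_sum] at this
  simp only [Matrix.mulVec, dotProduct, mul_one] at this
  have h2 : (G.degree u : ℝ) * ∑ v, lazyP G u v = G.degree u * 1 := by rw [this]; ring
  exact mul_left_cancel₀ h.ne' h2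

lemma aux_pow_row {V : Type} [Fintype V] (G : SimpleGraph V) (hd : ∀ u, 0 < G.degree u)
    (n : ℕ) : ∀ u : V, ∑ v, (lazyP G ^ n) u v = 1 := by
  induction n with
  | zero => intro u; simp [Matrix.one_apply]
  | succ n ih =>
    intro u
    simp_rw [pow_succ', Matrix.mul_apply]
    rw [Finset.sum_comm]
    simp_rw [← mul_sum, ih, mul_one]
    exact aux_row G hd u

lemma aux_adj_sq {V : Type} [Fintype V] (G : SimpleGraph V) (f : V → ℝ) :
    (∑ u, ∑ v, if G.Adj u v then (f v) ^ 2 else 0) = ∑ u, (G.degree u : ℝ) * f u ^ 2 := by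
  rw [Finset.sum_comm]
  refine Finset.sum_congr rfl fun v _ => ?_
  rw [← aux_adj_sum]
  simp_rw [G.adj_comm]

lemma aux_quad {V : Type} [Fintype V] (G : SimpleGraph V) (f : V → ℝ) (s : ℝ) :
    (∑ u, ∑ v, if G.Adj u v then (f u + s * f v) ^ 2 else 0)
      = (1 + s ^ 2) * ∑ u, (G.degree u : ℝ) * f u ^ 2
        + 2 * s * ∑ u, f u * ∑ v, if G.Adj u v then f v else 0 := by
  have : ∀ u v, (if G.Adj u v then (f u + s * f v) ^ 2 else 0)
      = (if G.Adj u v then (f u) ^ 2 else 0) + s ^ 2 * (if G.Adj u v then (f v) ^ 2 else 0)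
        + 2 * s * (f u * if G.Adj u v then f v else 0) := by
    intro u v; split_ifs <;> ring
  simp_rw [this, Finset.sum_add_distrib, ← mul_sum, aux_adj_sq, aux_adj_sum]
  ring

lemma aux_fPf {V : Type} [Fintype V] (G : SimpleGraph V) (hd : ∀ u, 0 < G.degree u)
    (f : V → ℝ) : ∑ u, (G.degree u : ℝ) * f u * (lazyP G).mulVec f u
      = (1 / 2) * ∑ u, (G.degree u : ℝ) * f u ^ 2
        + (1 / 2) * ∑ u, f u * ∑ v, if G.Adj u v then f v else 0 := by
  rw [mul_sum, mul_sum, ← Finset.sum_add_distrib]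
  refine Finset.sum_congr rfl fun u _ => ?_
  have := aux_mulVec G hd f u
  calc _ = f u * ((G.degree u : ℝ) * (lazyP G).mulVec f u) := by ring
    _ = _ := by rw [this]; ring

lemma aux_psd {V : Type} [Fintype V] (G : SimpleGraph V) (hd : ∀ u, 0 < G.degree u)
    (f : V → ℝ) : 0 ≤ ∑ u, (G.degree u : ℝ) * f u * (lazyP G).mulVec f u := by
  have h1 := aux_quad G f 1
  have h2 : 0 ≤ (∑ u, ∑ v, if G.Adj u v then (f u + 1 * f v) ^ 2 else 0) :=
    Finset.sum_nonneg fun u _ => Finset.sum_nonneg fun v _ => by split_ifs <;> positivity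
  rw [aux_fPf G hd]
  linarith

lemma aux_dirichlet {V : Type} [Fintype V] (G : SimpleGraph V) (hd : ∀ u, 0 < G.degree u)
    (f : V → ℝ) : ∑ u, (G.degree u : ℝ) * f u * (f u - (lazyP G).mulVec f u)
      = (1 / 4) * ∑ u, ∑ v, if G.Adj u v then (f u - f v) ^ 2 else 0 := by
  have h1 := aux_quad G f (-1)
  have h3 : ∀ u v, f u + -1 * f v = f u - f v := fun u v => by ring
  simp_rw [h3] at h1
  rw [h1]
  have h4 := aux_fPf G hd f
  simp_rw [mul_sub, Finset.sum_sub_distrib]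
  rw [h4]
  simp_rw [mul_assoc, ← sq]
  ring

lemma aux_eig_one {V : Type} [Fintype V] (G : SimpleGraph V) (hc : G.Connected)
    (hd : ∀ u, 0 < G.degree u) (f : V → ℝ) (hf : (lazyP G).mulVec f = f) :
    ∀ u v, f u = f v := by
  have h := aux_dirichlet G hd f
  rw [hf] at h
  simp only [sub_self, mul_zero, Finset.sum_const_zero] at h
  have h0 : (∑ u, ∑ v, if G.Adj u v then (f u - f v) ^ 2 else 0) = 0 := by linarith
  have hnn : ∀ u v, 0 ≤ (if G.Adj u v then (f u - f v) ^ 2 else 0) := by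
    intro u v; split_ifs <;> positivity
  have hadj : ∀ u v, G.Adj u v → f u = f v := by
    intro u v huv
    have h1 := (Finset.sum_eq_zero_iff_of_nonneg
      (fun u _ => Finset.sum_nonneg fun v _ => hnn u v)).1 h0 u (mem_univ _)
    have h2 := (Finset.sum_eq_zero_iff_of_nonneg (fun v _ => hnn u v)).1 h1 v (mem_univ _)
    rw [if_pos huv] at h2
    have := pow_eq_zero_iff (two_ne_zero) |>.1 h2
    linarith
  intro u v
  obtain ⟨p⟩ := hc.preconnected u v
  induction p with
  | nil => rfl
  | cons hab _ ih => exact (hadj _ _ hab).trans ih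

lemma aux_eig_le_one {V : Type} [Fintype V] (G : SimpleGraph V)
    (hd : ∀ u, 0 < G.degree u) (f : V → ℝ) (hf0 : f ≠ 0) (r : ℝ)
    (hf : (lazyP G).mulVec f = r • f) : r ≤ 1 := by
  have h := aux_dirichlet G hd f
  have hnn : 0 ≤ (∑ u, ∑ v, if G.Adj u v then (f u - f v) ^ 2 else 0) :=
    Finset.sum_nonneg fun u _ => Finset.sum_nonneg fun v _ => by split_ifs <;> positivity
  rw [hf] at h
  have h2 : ∑ u, (G.degree u : ℝ) * f u * (f u - (r • f) u)
      = (1 - r) * ∑ u, (G.degree u : ℝ) * f u ^ 2 := by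
    rw [mul_sum]; refine Finset.sum_congr rfl fun u _ => ?_
    simp; ring
  have hpos : 0 < ∑ u, (G.degree u : ℝ) * f u ^ 2 := by
    obtain ⟨u, hu⟩ := Function.ne_iff.1 hf0
    refine Finset.sum_pos' (fun u _ => by positivity) ⟨u, mem_univ _, ?_⟩
    have : (0 : ℝ) < G.degree u := by exact_mod_cast hd u
    have hu' : f u ≠ 0 := hu
    positivity
  rw [h2] at h
  by_contra hr
  push Not at hr
  nlinarith

lemma aux_set_finite {V : Type} [Fintype V] (P : Matrix V V ℝ) :
    {r : ℝ | r ≠ 1 ∧ ∃ f : V → ℝ, f ≠ 0 ∧ P.mulVec f = r • f}.Finite := by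
  refine (Module.End.finite_hasEigenvalue (Matrix.toLin' P)).subset ?_
  rintro r ⟨_, f, hf, h⟩
  exact Module.End.hasEigenvalue_of_hasEigenvector
    (x := f) ⟨Module.End.mem_eigenspace_iff.2 (by simpa using h), hf⟩

lemma aux_second_lt {V : Type} [Fintype V] (G : SimpleGraph V)
    (hd : ∀ u, 0 < G.degree u) : secondEig (lazyP G) < 1 := by
  unfold secondEig
  rcases Set.eq_empty_or_nonempty
    {r : ℝ | r ≠ 1 ∧ ∃ f : V → ℝ, f ≠ 0 ∧ (lazyP G).mulVec f = r • f} with h | h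
  · rw [h]; simp
  · obtain ⟨h1, f, hf, h2⟩ := h.csSup_mem (aux_set_finite (lazyP G))
    exact lt_of_le_of_ne (aux_eig_le_one G hd f hf _ h2) h1

lemma aux_le_second {V : Type} [Fintype V] (P : Matrix V V ℝ) (f : V → ℝ) (hf0 : f ≠ 0) (r : ℝ)
    (hf : P.mulVec f = r • f) (hr : r ≠ 1) : r ≤ secondEig P :=
  le_csSup (aux_set_finite P).bddAbove ⟨hr, f, hf0, hf⟩

lemma aux_relTime {V : Type} [Fintype V] (G : SimpleGraph V)
    (hd : ∀ u, 0 < G.degree u) : 1 ≤ (relTime (lazyP G) : ℝ) ∧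
      1 ≤ (relTime (lazyP G) : ℝ) * (1 - secondEig (lazyP G)) := by
  have h : 0 < 1 - secondEig (lazyP G) := by linarith [aux_second_lt G hd]
  constructor
  · have : 0 < relTime (lazyP G) := Nat.ceil_pos.2 (by positivity)
    exact_mod_cast this
  · have : 1 / (1 - secondEig (lazyP G)) ≤ (relTime (lazyP G) : ℝ) := Nat.le_ceil _
    rwa [div_le_iff₀ h] at this

lemma aux_poincare {V : Type} [Fintype V] (G : SimpleGraph V) (hc : G.Connected)
    (hd : ∀ u, 0 < G.degree u) (f : V → ℝ) (hf : ∑ u, (G.degree u : ℝ) * f u = 0) :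
    ∑ u, (G.degree u : ℝ) * f u ^ 2 ≤ (relTime (lazyP G) : ℝ) *
      ∑ u, (G.degree u : ℝ) * f u * (f u - (lazyP G).mulVec f u) := by
  obtain ⟨hT1, hT⟩ := aux_relTime G hd
  set T : ℝ := (relTime (lazyP G) : ℝ) with hTdef
  have hw : ∀ u, (0 : ℝ) < G.degree u := fun u => by exact_mod_cast hd u
  set s : V → ℝ := fun u => Real.sqrt (G.degree u) with hs
  have hs0 : ∀ u, 0 < s u := fun u => Real.sqrt_pos.2 (hw u)
  have hss : ∀ u, s u * s u = G.degree u := fun u => Real.mul_self_sqrt (hw u).le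
  set M : Matrix V V ℝ := fun u v => s u * lazyP G u v * (s v)⁻¹ with hMdef
  have hM : M.IsHermitian := by
    ext u v
    rw [Matrix.conjTranspose_apply, star_trivial]
    show s v * lazyP G v u * (s u)⁻¹ = s u * lazyP G u v * (s v)⁻¹
    have := aux_rev G hd u v
    rw [← hss, ← hss] at this
    have hu := (hs0 u).ne'
    have hv := (hs0 v).ne'
    field_simp
    linarith
  have hMs : ∀ u v, M u v = M v u := fun u v => by
    have := congrFun (congrFun hM v) u
    simpa using this
  set b := hM.eigenvectorBasis
  set μ := hM.eigenvalues
  have hb : ∀ j u, ∑ v, M u v * b j v = μ j * b j u := by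
    intro j u
    have := congrFun (hM.mulVec_eigenvectorBasis j) u
    simpa [Matrix.mulVec, dotProduct] using this
  set F : V → ℝ := fun u => s u * f u with hF
  set c : V → ℝ := fun j => ∑ u, b j u * F u with hcdef
  have pars : ∀ g : V → ℝ, ∑ u, F u * g u = ∑ j, c j * ∑ u, b j u * g u := by
    intro g
    have := b.sum_inner_mul_inner (WithLp.toLp 2 F) (WithLp.toLp 2 g)
    simp only [PiLp.inner_apply, RCLike.inner_apply, conj_trivial] at this
    rw [show ∑ u, F u * g u = ∑ u, g u * F u from Finset.sum_congr rfl fun _ _ => mul_comm _ _,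
      ← this]
    refine Finset.sum_congr rfl fun j _ => ?_
    congr 1
    exact Finset.sum_congr rfl fun _ _ => mul_comm _ _
  have e1 : ∑ u, (G.degree u : ℝ) * f u ^ 2 = ∑ j, c j ^ 2 := by
    have := pars F
    rw [show ∑ j, c j ^ 2 = ∑ j, c j * ∑ u, b j u * F u from
      Finset.sum_congr rfl fun _ _ => sq _, ← this]
    refine Finset.sum_congr rfl fun u _ => ?_
    rw [← hss]; simp only [hF]; ring
  have e2 : ∑ u, (G.degree u : ℝ) * f u * (lazyP G).mulVec f u = ∑ j, μ j * c j ^ 2 := by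
    have := pars (fun u => ∑ v, M u v * F v)
    have hl : ∑ u, F u * ∑ v, M u v * F v
        = ∑ u, (G.degree u : ℝ) * f u * (lazyP G).mulVec f u := by
      refine Finset.sum_congr rfl fun u _ => ?_
      simp only [Matrix.mulVec, dotProduct, mul_sum]
      refine Finset.sum_congr rfl fun v _ => ?_
      rw [← hss]; simp only [hF, hMdef]
      have hv := (hs0 v).ne'
      field_simp
    rw [← hl, this]
    refine Finset.sum_congr rfl fun j _ => ?_
    have : ∑ u, b j u * ∑ v, M u v * F v = μ j * c j := by
      simp only [hcdef, mul_sum]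
      rw [Finset.sum_comm]
      refine Finset.sum_congr rfl fun v _ => ?_
      rw [← mul_assoc, ← hb j v, sum_mul]
      refine Finset.sum_congr rfl fun u _ => ?_
      rw [hMs u v]; ring
    rw [this]; ring
  have e3 : ∑ u, (G.degree u : ℝ) * f u * (f u - (lazyP G).mulVec f u)
      = ∑ j, (1 - μ j) * c j ^ 2 := by
    simp_rw [mul_sub, Finset.sum_sub_distrib, sub_mul, one_mul, Finset.sum_sub_distrib]
    rw [e2, ← e1]
    congr 1
    exact Finset.sum_congr rfl fun _ _ => by ring
  rw [e1, e3, mul_sum]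
  refine Finset.sum_le_sum fun j _ => ?_
  set e : V → ℝ := fun u => b j u / s u with he
  have hbe : ∀ u, b j u = e u * s u := fun u => by
    simp only [he]; rw [div_mul_cancel₀ _ (hs0 u).ne']
  have hPe : (lazyP G).mulVec e = μ j • e := by
    ext u
    have := hb j u
    have h2 : ∑ v, M u v * b j v = s u * (lazyP G).mulVec e u := by
      simp only [Matrix.mulVec, dotProduct, mul_sum]
      refine Finset.sum_congr rfl fun v _ => ?_
      simp only [hMdef, he]; ring
    rw [h2, hbe u] at this
    have hu := (hs0 u).ne'
    simp only [Pi.smul_apply, smul_eq_mul]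
    apply mul_left_cancel₀ hu
    rw [this]; ring
  have he0 : e ≠ 0 := by
    intro h0
    have : b j = 0 := by
      ext u
      rw [hbe u, h0]; simp
    exact b.orthonormal.ne_zero j this
  by_cases hμ : μ j = 1
  · rw [hμ, one_smul] at hPe
    have hconst := aux_eig_one G hc hd e hPe
    have hc0 : c j = 0 := by
      obtain ⟨v⟩ := hc.nonempty
      have : c j = e v * ∑ u, (G.degree u : ℝ) * f u := by
        simp only [hcdef, mul_sum]
        refine Finset.sum_congr rfl fun u _ => ?_
        rw [hbe u, ← hss, hconst u v]; simp only [hF]; ring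
      rw [this, hf, mul_zero]
    rw [hc0]; simp
  · have := aux_le_second (lazyP G) e he0 _ hPe hμ
    have h1 : 1 ≤ T * (1 - μ j) := hT.trans (by gcongr)
    nlinarith [sq_nonneg (c j)]

lemma aux_path {V : Type} [Fintype V] (G : SimpleGraph V) (h : V → ℝ) (B : ℝ)
    (hE : (∑ u, ∑ v, if G.Adj u v then (h u - h v) ^ 2 else 0) ≤ B)
    (y : ℕ → V) (L : ℕ) (hadj : ∀ i < L, G.Adj (y i) (y (i + 1)))
    (hinj : ∀ i ≤ L, ∀ j ≤ L, y i = y j → i = j) :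
    ∀ j ≤ L, (h (y 0) - h (y j)) ^ 2 ≤ j * B := by
  intro j hj
  have h1 : h (y 0) - h (y j) = ∑ i ∈ range j, (h (y i) - h (y (i + 1))) := by
    rw [Finset.sum_range_sub' (fun i => h (y i))]
  have h2 : ∑ i ∈ range j, (h (y i) - h (y (i + 1))) ^ 2 ≤ B := by
    refine le_trans ?_ hE
    rw [← Finset.sum_product']
    have h3 : ∑ i ∈ range j, (h (y i) - h (y (i + 1))) ^ 2
      = ∑ e ∈ (range j).image (fun i => (y i, y (i + 1))),
          if G.Adj e.1 e.2 then (h e.1 - h e.2) ^ 2 else 0 := by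
      rw [Finset.sum_image]
      · refine Finset.sum_congr rfl fun i hi => ?_
        rw [if_pos (hadj i (by simp at hi; omega))]
      · intro a ha b hb hab
        simp at ha hb hab
        exact hinj a (by omega) b (by omega) hab.1
    rw [h3]
    refine Finset.sum_le_sum_of_subset_of_nonneg (by intro e _; simp) ?_
    intro e _ _
    split_ifs <;> positivity
  rw [h1]
  refine (sq_sum_le_card_mul_sum_sq).trans ?_
  rw [Finset.card_range]
  gcongr

lemma aux_nbr_sq {V : Type} [Fintype V] (G : SimpleGraph V) (h : V → ℝ) (v : V) (a : ℝ)
    (hd : 0 < G.degree v) (ha : 0 ≤ a)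
    (hv : (G.degree v : ℝ) * a ≤ ∑ w, if G.Adj v w then h w else 0) :
    (G.degree v : ℝ) * a ^ 2 ≤ ∑ w ∈ G.neighborFinset v, h w ^ 2 := by
  have hw : (0 : ℝ) < G.degree v := by exact_mod_cast hd
  have h1 : (∑ w, if G.Adj v w then h w else 0) = ∑ w ∈ G.neighborFinset v, h w := by
    rw [← Finset.sum_filter, G.neighborFinset_eq_filter]
  rw [h1] at hv
  have h2 := sq_sum_le_card_mul_sum_sq (s := G.neighborFinset v) (f := h)
  rw [G.card_neighborFinset_eq_degree] at h2
  have h3 : ((G.degree v : ℝ) * a) ^ 2 ≤ (∑ w ∈ G.neighborFinset v, h w) ^ 2 := by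
    gcongr
  have h4 := h3.trans h2
  have h5 : (G.degree v : ℝ) * ((G.degree v : ℝ) * a ^ 2)
      ≤ G.degree v * ∑ w ∈ G.neighborFinset v, h w ^ 2 := by
    calc _ = ((G.degree v : ℝ) * a) ^ 2 := by ring
      _ ≤ _ := h4
  exact le_of_mul_le_mul_left h5 hw

lemma aux_ball {V : Type} [Fintype V] (G : SimpleGraph V) (hc : G.Connected)
    (hd : ∀ u, 0 < G.degree u) (x : V) (h : V → ℝ) (W T d : ℝ) (hW : 0 < W) (hT : 1 ≤ T)
    (hd0 : 0 < d) (hdd : ∀ u, d ≤ G.degree u)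
    (hE : (∑ u, ∑ v, if G.Adj u v then (h u - h v) ^ 2 else 0) ≤ 4 * W * h x)
    (hnbr : ∀ v, (G.degree v : ℝ) * h v - (if v = x then 2 * W else 0)
      ≤ ∑ w, if G.Adj v w then h w else 0)
    (hmin : ∃ z, h z ≤ 0)
    (hN : ∑ u, (G.degree u : ℝ) * h u ^ 2 ≤ T * W * h x) :
    h x ≤ 14 * Real.sqrt T * W / d := by
  set A := h x with hA
  have hsT : 1 ≤ Real.sqrt T := by rw [Real.one_le_sqrt]; exact hT
  rcases lt_or_ge A (4 * W / d) with hlt | hge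
  · refine hlt.le.trans ?_
    gcongr
    linarith
  have hApos : 0 < A := lt_of_lt_of_le (by positivity) hge
  obtain ⟨z, hz⟩ := hmin
  obtain ⟨p, hp⟩ := hc.exists_walk_length_eq_dist x z
  set L := p.length with hL
  set y : ℕ → V := fun i => p.getVert i with hy
  have hy0 : y 0 = x := by simp [hy]
  have hyL : y L = z := by simp [hy, hL]
  have hadj : ∀ i < L, G.Adj (y i) (y (i + 1)) := fun i hi => p.adj_getVert_succ hi
  have hstep : ∀ i k, i + k ≤ L → G.dist (y i) (y (i + k)) ≤ k := by
    intro i k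
    induction k with
    | zero => intro _; simp
    | succ k ih =>
      intro hk
      have h1 := ih (by omega)
      have h2 : G.dist (y (i + k)) (y (i + k + 1)) = 1 :=
        SimpleGraph.dist_eq_one_iff_adj.2 (hadj _ (by omega))
      have h3 := hc.dist_triangle (u := y i) (v := y (i + k)) (w := y (i + k + 1))
      rw [← add_assoc]
      omega
  have hgeo : ∀ i j, i ≤ j → j ≤ L → j - i ≤ G.dist (y i) (y j) := by
    intro i j hij hj
    have h1 := hstep 0 i (by omega)
    have h2 := hstep j (L - j) (by omega)
    rw [show j + (L - j) = L by omega, hyL] at h2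
    rw [zero_add, hy0] at h1
    have h3 := hc.dist_triangle (u := x) (v := y i) (w := z)
    have h4 := hc.dist_triangle (u := y i) (v := y j) (w := z)
    omega
  have hinj : ∀ i ≤ L, ∀ j ≤ L, y i = y j → i = j := by
    intro i hi j hj hij
    rcases le_total i j with hle | hle
    · have := hgeo i j hle hj
      rw [hij] at this; simp at this; omega
    · have := hgeo j i hle hi
      rw [hij] at this; simp at this; omega
  have hpath := aux_path G h (4 * W * A) hE y L hadj hinj
  rw [hy0] at hpath
  set N := ⌊A / (48 * W)⌋₊ with hNdef
  have hN1 : (N : ℝ) ≤ A / (48 * W) := Nat.floor_le (by positivity)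
  have hN2 : A / (48 * W) < N + 1 := Nat.lt_floor_add_one _
  rw [le_div_iff₀ (by positivity)] at hN1
  rw [div_lt_iff₀ (by positivity)] at hN2
  have hLN : 3 * N ≤ L := by
    have h1 := hpath L le_rfl
    rw [hyL] at h1
    have h2 : A ^ 2 ≤ (A - h z) ^ 2 := by gcongr; linarith
    have h3 : A * A ≤ (L * (4 * W)) * A := by nlinarith
    have h4 : A ≤ L * (4 * W) := le_of_mul_le_mul_right h3 hApos
    have h5 : (N : ℝ) * 12 * (4 * W) ≤ L * (4 * W) := by nlinarith
    have h6 : (N : ℝ) * 12 ≤ L := le_of_mul_le_mul_right h5 (by positivity)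
    have h7 : N * 12 ≤ L := by exact_mod_cast h6
    omega
  have hkey : ∀ k ∈ range (N + 1), d * (A / 2) ^ 2 ≤
      ∑ w ∈ G.neighborFinset (y (3 * k)), h w ^ 2 := by
    intro k hk
    have hkN : k ≤ N := by simp at hk; omega
    refine le_trans ?_ (aux_nbr_sq G h (y (3 * k)) (A / 2) (hd _) (by positivity) ?_)
    · gcongr; exact hdd _
    · refine le_trans ?_ (hnbr _)
      rcases Nat.eq_zero_or_pos k with h0 | h0
      · subst h0
        have hx0 : y (3 * 0) = x := by simpa using hy0
        rw [hx0, if_pos rfl]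
        rw [div_le_iff₀ hd0] at hge
        have := mul_le_mul_of_nonneg_left (hdd x) hApos.le
        rw [← hA]
        nlinarith
      · have hne : y (3 * k) ≠ x := by
          intro hh
          rw [← hy0] at hh
          have := hinj _ (by omega) _ (by omega) hh
          omega
        rw [if_neg hne, sub_zero]
        gcongr
        have h1 := hpath (3 * k) (by omega)
        push_cast at h1
        have h2 : (k : ℝ) ≤ N := by exact_mod_cast hkN
        have h3 : (k : ℝ) * (48 * W) ≤ A := le_trans (by gcongr) hN1
        have h4 : (A - h (y (3 * k))) ^ 2 ≤ (A / 2) ^ 2 := by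
          refine h1.trans ?_
          nlinarith
        have := abs_le_of_sq_le_sq h4 (by positivity)
        linarith [(abs_le.1 this).2]
  have hdisj : Set.PairwiseDisjoint (↑(range (N + 1)) : Set ℕ)
      (fun k => G.neighborFinset (y (3 * k))) := by
    intro a ha b hb hab
    simp only [Function.onFun]
    rw [Finset.disjoint_left]
    intro w hwa hwb
    rw [SimpleGraph.mem_neighborFinset] at hwa hwb
    have ha' : a ≤ N := by simp at ha; omega
    have hb' : b ≤ N := by simp at hb; omega
    have d1 := SimpleGraph.dist_eq_one_iff_adj.2 hwa
    have d2 := SimpleGraph.dist_eq_one_iff_adj.2 hwb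
    have d1' := SimpleGraph.dist_eq_one_iff_adj.2 hwa.symm
    have d2' := SimpleGraph.dist_eq_one_iff_adj.2 hwb.symm
    rcases lt_or_gt_of_ne hab with hlt | hlt
    · have h1 := hgeo (3 * a) (3 * b) (by omega) (by omega)
      have h2 := hc.dist_triangle (u := y (3 * a)) (v := w) (w := y (3 * b))
      omega
    · have h1 := hgeo (3 * b) (3 * a) (by omega) (by omega)
      have h2 := hc.dist_triangle (u := y (3 * b)) (v := w) (w := y (3 * a))
      omega
  have hsum : ((N : ℝ) + 1) * (d * (A / 2) ^ 2) ≤ ∑ w, h w ^ 2 := by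
    have h1 := Finset.sum_le_sum hkey
    rw [Finset.sum_const, Finset.card_range, nsmul_eq_mul, ← Finset.sum_biUnion hdisj] at h1
    push_cast at h1
    refine h1.trans (Finset.sum_le_sum_of_subset_of_nonneg (Finset.subset_univ _) ?_)
    intro _ _ _; positivity
  have hsum2 : d * (((N : ℝ) + 1) * (d * (A / 2) ^ 2)) ≤ T * W * A := by
    refine le_trans ?_ hN
    refine le_trans (mul_le_mul_of_nonneg_left hsum hd0.le) ?_
    rw [mul_sum]
    refine Finset.sum_le_sum fun u _ => ?_
    gcongr; exact hdd u
  have h3 : (d ^ 2 * A * (N + 1)) * A ≤ (4 * T * W) * A := by nlinarith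
  have h4 := le_of_mul_le_mul_right h3 hApos
  have h5 : (d * A) ^ 2 ≤ (14 * Real.sqrt T * W) ^ 2 := by
    have hsq : Real.sqrt T ^ 2 = T := Real.sq_sqrt (by linarith)
    have h6 : d ^ 2 * A * A ≤ d ^ 2 * A * ((N + 1) * (48 * W)) := by gcongr
    calc (d * A) ^ 2 = d ^ 2 * A * A := by ring
      _ ≤ (d ^ 2 * A * (N + 1)) * (48 * W) := by linarith
      _ ≤ (4 * T * W) * (48 * W) := by gcongr
      _ ≤ 196 * T * W ^ 2 := by nlinarith [mul_pos (lt_of_lt_of_le one_pos hT) (pow_pos hW 2)]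
      _ = _ := by rw [mul_pow, mul_pow, hsq]; ring
  have h7 := abs_le_of_sq_le_sq h5 (by positivity)
  rw [le_div_iff₀ hd0]
  linarith [(abs_le.1 h7).2]

noncomputable def auxW {V : Type} [Fintype V] (G : SimpleGraph V) : ℝ := ∑ u, (G.degree u : ℝ)

noncomputable def auxF {V : Type} [Fintype V] (G : SimpleGraph V) (x : V) (i : ℕ) (u : V) : ℝ :=
  auxW G * (lazyP G ^ i) u x / (G.degree x : ℝ) - 1

noncomputable def auxM1 {V : Type} [Fintype V] (G : SimpleGraph V) (t : ℕ) (x : V) : ℝ :=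
  ∑ v, green (lazyP G) t x v ^ 2 / (G.degree v : ℝ)

lemma auxF_sum {V : Type} [Fintype V] (G : SimpleGraph V) (hd : ∀ u, 0 < G.degree u)
    (x : V) (i : ℕ) : ∑ u, (G.degree u : ℝ) * auxF G x i u = 0 := by
  have hx : (G.degree x : ℝ) ≠ 0 := by exact_mod_cast (hd x).ne'
  have : ∀ u, (G.degree u : ℝ) * auxF G x i u = auxW G * (lazyP G ^ i) x u - G.degree u := by
    intro u
    have h := aux_pow_rev G hd i u x
    unfold auxF
    rw [mul_sub, mul_one]
    congr 1
    field_simp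
    linear_combination (auxW G) * h
  simp_rw [this]
  rw [Finset.sum_sub_distrib, ← mul_sum, aux_pow_row G hd, mul_one]
  unfold auxW; ring

lemma auxF_inner {V : Type} [Fintype V] (G : SimpleGraph V) (hd : ∀ u, 0 < G.degree u)
    (x : V) (i j : ℕ) : ∑ u, (G.degree u : ℝ) * auxF G x i u * auxF G x j u
      = auxW G * auxF G x (i + j) x := by
  have hx : (G.degree x : ℝ) ≠ 0 := by exact_mod_cast (hd x).ne'
  have h1 : ∀ u, (G.degree u : ℝ) * auxF G x i u * auxF G x j u
      = auxW G * (auxW G / G.degree x) * ((lazyP G ^ i) x u * (lazyP G ^ j) u x)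
        - auxW G * (lazyP G ^ i) x u - (G.degree u : ℝ) * auxF G x j u := by
    intro u
    have h := aux_pow_rev G hd i u x
    have h2 : (G.degree u : ℝ) * auxF G x i u = auxW G * (lazyP G ^ i) x u - G.degree u := by
      unfold auxF
      rw [mul_sub, mul_one]
      congr 1
      field_simp
      linear_combination (auxW G) * h
    rw [h2, sub_mul]
    congr 1
    unfold auxF
    field_simp
  simp_rw [h1]
  rw [Finset.sum_sub_distrib, Finset.sum_sub_distrib, auxF_sum G hd, ← mul_sum, ← mul_sum,
    aux_pow_row G hd, ← Matrix.mul_apply, ← pow_add]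
  unfold auxF
  field_simp
  ring

lemma auxF_mulVec {V : Type} [Fintype V] (G : SimpleGraph V) (hd : ∀ u, 0 < G.degree u)
    (x : V) (i : ℕ) (u : V) : (lazyP G).mulVec (auxF G x i) u = auxF G x (i + 1) u := by
  simp only [Matrix.mulVec, dotProduct, auxF, mul_sub, mul_one, Finset.sum_sub_distrib,
    aux_row G hd]
  rw [pow_succ', Matrix.mul_apply, mul_sum, sum_div]
  congr 1
  exact Finset.sum_congr rfl fun v _ => by ring

lemma auxW_pos {V : Type} [Fintype V] (G : SimpleGraph V) (hd : ∀ u, 0 < G.degree u) (x : V) :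
    0 < auxW G :=
  Finset.sum_pos (fun u _ => by exact_mod_cast hd u) ⟨x, mem_univ _⟩

lemma auxF_nonneg {V : Type} [Fintype V] (G : SimpleGraph V) (hd : ∀ u, 0 < G.degree u)
    (x : V) (k : ℕ) : 0 ≤ auxF G x k x := by
  have hW := auxW_pos G hd x
  have : 0 ≤ auxW G * auxF G x k x := by
    rcases Nat.even_or_odd' k with ⟨l, rfl | rfl⟩
    · rw [two_mul, ← auxF_inner G hd]
      refine Finset.sum_nonneg fun u _ => ?_
      rw [mul_assoc]
      exact mul_nonneg (by positivity) (mul_self_nonneg _)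
    · rw [two_mul, add_assoc, ← auxF_inner G hd]
      have := aux_psd G hd (auxF G x l)
      simp_rw [auxF_mulVec G hd] at this
      exact this
  exact nonneg_of_mul_nonneg_right this hW

lemma aux_mean {V : Type} [Fintype V] (G : SimpleGraph V) (hc : G.Connected)
    (hd : ∀ u, 0 < G.degree u) (d : ℝ) (hd0 : 0 < d) (hdd : ∀ u, d ≤ G.degree u)
    (t : ℕ) (x : V) :
    (t : ℝ) ^ 2 ≤ auxW G * auxM1 G t x ∧
    auxW G * auxM1 G t x ≤ (t : ℝ) ^ 2 + (relTime (lazyP G) : ℝ) *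
      (14 * Real.sqrt (relTime (lazyP G) : ℝ) * auxW G / d) := by
  have hW := auxW_pos G hd x
  have hw : ∀ u, (0 : ℝ) < G.degree u := fun u => by exact_mod_cast hd u
  obtain ⟨hT1, -⟩ := aux_relTime G hd
  set T : ℝ := (relTime (lazyP G) : ℝ)
  set W := auxW G with hWdef
  set h : V → ℝ := fun u => ∑ i ∈ range t, auxF G x i u with hh
  have hsum : ∑ u, (G.degree u : ℝ) * h u = 0 := by
    simp only [hh, mul_sum]
    rw [Finset.sum_comm]
    exact Finset.sum_eq_zero fun i _ => auxF_sum G hd x i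
  have hP : ∀ u, h u - (lazyP G).mulVec h u = auxF G x 0 u - auxF G x t u := by
    intro u
    have : (lazyP G).mulVec h u = ∑ i ∈ range t, auxF G x (i + 1) u := by
      simp_rw [← auxF_mulVec G hd]
      simp only [Matrix.mulVec, dotProduct, hh, mul_sum]
      rw [Finset.sum_comm]
    rw [this]
    simp only [hh]
    rw [← Finset.sum_sub_distrib, Finset.sum_range_sub' (fun i => auxF G x i u)]
  have hEn : ∑ u, (G.degree u : ℝ) * h u * (h u - (lazyP G).mulVec h u) ≤ W * h x := by
    simp_rw [hP]
    have : ∑ u, (G.degree u : ℝ) * h u * (auxF G x 0 u - auxF G x t u)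
        = ∑ i ∈ range t, (W * auxF G x i x - W * auxF G x (i + t) x) := by
      have e : ∀ i, W * auxF G x i x - W * auxF G x (i + t) x
        = ∑ u, (G.degree u : ℝ) * auxF G x i u * (auxF G x 0 u - auxF G x t u) := by
        intro i
        rw [← auxF_inner G hd]
        conv_lhs => rw [← add_zero i]
        rw [← auxF_inner G hd, ← Finset.sum_sub_distrib]
        simp only [add_zero]
        exact Finset.sum_congr rfl fun _ _ => by ring
      simp_rw [e]
      rw [Finset.sum_comm]
      refine Finset.sum_congr rfl fun u _ => ?_
      simp only [hh, mul_sum, sum_mul]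
    rw [this]
    simp only [hh, mul_sum]
    refine Finset.sum_le_sum fun i _ => ?_
    have := mul_nonneg hW.le (auxF_nonneg G hd x (i + t))
    linarith
  have hpoin := aux_poincare G hc hd h hsum
  have hN : ∑ u, (G.degree u : ℝ) * h u ^ 2 ≤ T * W * h x := by
    refine hpoin.trans ?_
    rw [mul_assoc]
    gcongr
  have hball := aux_ball G hc hd x h W T d hW hT1 hd0 hdd (by
      have := aux_dirichlet G hd h
      linarith) (by
      intro v
      have h1 := aux_mulVec G hd h v
      have h2 : (G.degree v : ℝ) * (h v - (lazyP G).mulVec h v) ≤ if v = x then W else 0 := by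
        rw [hP]
        have h3 : auxF G x 0 v - auxF G x t v = W / G.degree x *
          ((if v = x then 1 else 0) - (lazyP G ^ t) v x) := by
          simp only [auxF, pow_zero, Matrix.one_apply]; ring
        rw [h3]
        have h4 := aux_pow_nonneg G t v x
        have hx := hw x
        split_ifs with hvx
        · subst hvx
          have : (G.degree v : ℝ) * (W / G.degree v * (1 - (lazyP G ^ t) v v))
            = W * (1 - (lazyP G ^ t) v v) := by field_simp
          rw [this]
          nlinarith
        · have : 0 ≤ (G.degree v : ℝ) * (W / G.degree x * (lazyP G ^ t) v x) := by positivity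
          linarith
      have h5 : (if v = x then 2 * W else 0) = 2 * (if v = x then W else 0) := by
        split_ifs <;> ring
      rw [h5]
      linarith) (by
      by_contra hcon
      push Not at hcon
      have : 0 < ∑ u, (G.degree u : ℝ) * h u :=
        Finset.sum_pos (fun u _ => mul_pos (hw u) (hcon u)) ⟨x, mem_univ _⟩
      linarith) hN
  have hid : ∑ u, (G.degree u : ℝ) * h u ^ 2 = W * (W * auxM1 G t x - (t : ℝ) ^ 2) := by
    have h1 : ∀ u, h u = W * green (lazyP G) t x u / G.degree u - t := by
      intro u
      simp only [hh, auxF, Finset.sum_sub_distrib, green, mul_sum, sum_div]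
      simp only [Finset.sum_const, card_range, nsmul_eq_mul, mul_one]
      congr 1
      refine Finset.sum_congr rfl fun i _ => ?_
      have := aux_pow_rev G hd i u x
      have hx := hw x
      have hu := hw u
      field_simp
      rw [hWdef]
      linear_combination (auxW G) * this
    have h2 : ∀ u, (G.degree u : ℝ) * h u ^ 2 = W ^ 2 * (green (lazyP G) t x u ^ 2 / G.degree u)
        - 2 * W * t * green (lazyP G) t x u + t ^ 2 * G.degree u := by
      intro u
      have hu := hw u
      rw [h1]
      field_simp
      ring
    have h3 : ∑ u, green (lazyP G) t x u = t := by
      unfold green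
      rw [Finset.sum_comm]
      simp [aux_pow_row G hd]
    simp_rw [h2]
    rw [Finset.sum_add_distrib, Finset.sum_sub_distrib, ← mul_sum, ← mul_sum, ← mul_sum, h3]
    have h4 : ∑ u, (G.degree u : ℝ) = W := rfl
    rw [h4]
    unfold auxM1
    ring
  have hnn : 0 ≤ ∑ u, (G.degree u : ℝ) * h u ^ 2 := Finset.sum_nonneg fun u _ => by positivity
  constructor
  · rw [hid] at hnn
    have := nonneg_of_mul_nonneg_right hnn hW
    linarith
  · rw [hid] at hN
    have h1 : W * (W * auxM1 G t x - (t : ℝ) ^ 2) ≤ W * (T * h x) := by linarith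
    have h2 := le_of_mul_le_mul_left h1 hW
    have h3 : T * h x ≤ T * (14 * Real.sqrt T * W / d) := by gcongr
    linarith

lemma aux_traj_zero {V : Type} [Nonempty V] {n : ℕ} (a : V) (q : Fin n → V) :
    traj (Fin.cons a q : Fin (n + 1) → V) 0 = a := by
  simp [traj]

lemma aux_traj_succ {V : Type} [Nonempty V] {n : ℕ} (a : V) (q : Fin n → V) (i : ℕ) :
    traj (Fin.cons a q : Fin (n + 1) → V) (i + 1) = traj q i := by
  unfold traj
  by_cases h : i < n
  · rw [dif_pos h, dif_pos (by omega)]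
    exact Fin.cons_succ (α := fun _ => V) a q ⟨i, h⟩
  · rw [dif_neg h, dif_neg (by omega)]

noncomputable def auxE {V : Type} [Fintype V] [Nonempty V] (P : Matrix V V ℝ) (x : V) (t : ℕ)
    (F : (Fin t → V) → ℝ) : ℝ := ∑ p, pathWeight P x t p * F p

lemma auxE_rec {V : Type} [Fintype V] [Nonempty V] (P : Matrix V V ℝ) (x : V) (n : ℕ)
    (F : (Fin (n + 2) → V) → ℝ) :
    auxE P x (n + 2) F = ∑ y, P x y * auxE P y (n + 1) (fun q => F (Fin.cons x q)) := by
  unfold auxE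
  rw [← (Fin.consEquiv (fun _ => V)).sum_comp, Fintype.sum_prod_type]
  simp only [Fin.consEquiv, Equiv.coe_fn_mk]
  have h1 : ∀ a (q : Fin (n + 1) → V), pathWeight P x (n + 2) (Fin.cons a q)
      = (if a = x then 1 else 0) * (P a (traj q 0) *
        ∏ i ∈ range n, P (traj q i) (traj q (i + 1))) := by
    intro a q
    unfold pathWeight
    rw [aux_traj_zero]
    congr 1
    rw [show n + 2 - 1 = n + 1 by omega, Finset.prod_range_succ', mul_comm]
    simp_rw [aux_traj_succ, aux_traj_zero]
  simp_rw [h1]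
  rw [Finset.sum_eq_single x]
  · simp_rw [mul_sum]
    rw [Finset.sum_comm]
    refine Finset.sum_congr rfl fun q _ => ?_
    unfold pathWeight
    rw [Finset.sum_eq_single (traj q 0)]
    · simp; ring
    · intro b _ hb
      rw [if_neg (Ne.symm hb)]; simp
    · simp
  · intro b _ hb
    simp [hb]
  · simp

lemma auxE_one {V : Type} [Fintype V] [Nonempty V] (P : Matrix V V ℝ) (x : V)
    (F : (Fin 1 → V) → ℝ) : auxE P x 1 F = F (Fin.cons x Fin.elim0) := by
  unfold auxE
  rw [← (Fin.consEquiv (fun _ => V)).sum_comp, Fintype.sum_prod_type]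
  simp only [Fin.consEquiv, Equiv.coe_fn_mk]
  rw [Finset.sum_eq_single x]
  · rw [Fintype.sum_unique]
    simp only [pathWeight, aux_traj_zero]
    simp
    congr 2
  · intro b _ hb
    simp only [pathWeight, aux_traj_zero]
    simp [hb]
  · simp

lemma auxE_congr {V : Type} [Fintype V] [Nonempty V] (P : Matrix V V ℝ) (x : V) (t : ℕ)
    (F F' : (Fin t → V) → ℝ) (h : ∀ p, F p = F' p) : auxE P x t F = auxE P x t F' := by
  rw [funext h]

lemma auxE_smul {V : Type} [Fintype V] [Nonempty V] (P : Matrix V V ℝ) (x : V) (t : ℕ)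
    (c : ℝ) (F : (Fin t → V) → ℝ) : auxE P x t (fun p => c * F p) = c * auxE P x t F := by
  unfold auxE
  rw [mul_sum]
  exact Finset.sum_congr rfl fun _ _ => by ring

lemma auxE_sum {V ι : Type} [Fintype V] [Nonempty V] (P : Matrix V V ℝ) (x : V) (t : ℕ)
    (s : Finset ι) (F : ι → (Fin t → V) → ℝ) :
    auxE P x t (fun p => ∑ i ∈ s, F i p) = ∑ i ∈ s, auxE P x t (F i) := by
  unfold auxE
  simp_rw [mul_sum]
  rw [Finset.sum_comm]

lemma auxE_total {V : Type} [Fintype V] [Nonempty V] (P : Matrix V V ℝ)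
    (hP : ∀ u, ∑ v, P u v = 1) (n : ℕ) : ∀ x, auxE P x (n + 1) (fun _ => 1) = 1 := by
  induction n with
  | zero => intro x; rw [auxE_one]
  | succ n ih => intro x; rw [auxE_rec]; simp_rw [ih, mul_one]; exact hP x

lemma auxE_single {V : Type} [Fintype V] [Nonempty V] (P : Matrix V V ℝ)
    (hP : ∀ u, ∑ v, P u v = 1) (n : ℕ) : ∀ (x : V) (i : ℕ) (_ : i ≤ n) (u : V),
    auxE P x (n + 1) (fun p => if traj p i = u then 1 else 0) = (P ^ i) x u := by
  induction n with
  | zero =>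
    intro x i hi u
    obtain rfl : i = 0 := by omega
    rw [auxE_one, aux_traj_zero, pow_zero, Matrix.one_apply]
  | succ n ih =>
    intro x i hi u
    rw [auxE_rec]
    cases i with
    | zero =>
      simp_rw [aux_traj_zero]
      have := auxE_smul P (t := n + 1) (c := if x = u then (1 : ℝ) else 0) (F := fun _ => 1)
      simp only [mul_one] at this
      simp_rw [this, auxE_total P hP, mul_one, ← sum_mul, hP, one_mul]
      rw [pow_zero, Matrix.one_apply]
    | succ i =>
      simp_rw [aux_traj_succ]
      rw [pow_succ', Matrix.mul_apply]
      refine Finset.sum_congr rfl fun y _ => ?_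
      rw [ih y i (by omega)]

lemma auxE_pair {V : Type} [Fintype V] [Nonempty V] (P : Matrix V V ℝ)
    (hP : ∀ u, ∑ v, P u v = 1) (n : ℕ) : ∀ (x : V) (i k : ℕ) (_ : i ≤ k) (_ : k ≤ n) (u v : V),
    auxE P x (n + 1) (fun p => (if traj p i = u then 1 else 0) * (if traj p k = v then 1 else 0))
      = (P ^ i) x u * (P ^ (k - i)) u v := by
  induction n with
  | zero =>
    intro x i k hi hk u v
    obtain rfl : k = 0 := by omega
    obtain rfl : i = 0 := by omega
    rw [auxE_one, aux_traj_zero]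
    simp only [pow_zero, Matrix.one_apply]
    by_cases h : x = u
    · subst h; simp [Matrix.one_apply]
    · simp [h]
  | succ n ih =>
    intro x i k hi hk u v
    cases i with
    | zero =>
      have h0 : ∀ p : Fin (n + 2) → V, pathWeight P x (n + 2) p *
          ((if traj p 0 = u then 1 else 0) * (if traj p k = v then 1 else 0))
          = pathWeight P x (n + 2) p *
          ((if x = u then 1 else 0) * (if traj p k = v then 1 else 0)) := by
        intro p
        by_cases h : traj p 0 = x
        · rw [h]
        · simp [pathWeight, h]
      have h1 : auxE P x (n + 1 + 1) (fun p => (if traj p 0 = u then 1 else 0) *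
          (if traj p k = v then 1 else 0))
        = auxE P x (n + 1 + 1) (fun p => (if x = u then 1 else 0) *
          (if traj p k = v then 1 else 0)) := by
        unfold auxE
        exact Finset.sum_congr rfl fun p _ => h0 p
      rw [h1, auxE_smul, auxE_single P hP (n + 1) x k hk]
      simp only [pow_zero, Matrix.one_apply, Nat.sub_zero]
      by_cases h : x = u
      · subst h; simp
      · simp [h]
    | succ i =>
      obtain ⟨k, rfl⟩ : ∃ k', k = k' + 1 := ⟨k - 1, by omega⟩
      rw [auxE_rec]
      simp_rw [aux_traj_succ]
      rw [pow_succ', Matrix.mul_apply, sum_mul]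
      refine Finset.sum_congr rfl fun y _ => ?_
      rw [ih y i k (by omega) (by omega), show k + 1 - (i + 1) = k - i by omega]
      ring

/-- local time -/
noncomputable def auxL {V : Type} [Nonempty V] {t : ℕ} (p : Fin t → V) (u : V) : ℝ :=
  ∑ i ∈ range t, if traj p i = u then 1 else 0

lemma aux_wInter {V : Type} [Fintype V] [Nonempty V] (G : SimpleGraph V) {t : ℕ}
    (p q : Fin t → V) : wInter G p q = ∑ u, auxL p u * auxL q u * (1 / (G.degree u : ℝ)) := by
  unfold wInter wInterIco auxL
  rw [← Finset.range_eq_Ico]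
  simp_rw [sum_mul_sum, sum_mul]
  rw [Finset.sum_comm]
  conv_rhs => rw [Finset.sum_comm]
  rw [Finset.sum_comm]
  refine Finset.sum_congr rfl fun i _ => ?_
  rw [Finset.sum_comm]
  refine Finset.sum_congr rfl fun j _ => ?_
  rw [Finset.sum_eq_single (traj p i)]
  · simp [eq_comm]
  · intro b _ hb
    rw [if_neg (Ne.symm hb)]; simp
  · simp

lemma auxE_L {V : Type} [Fintype V] [Nonempty V] (P : Matrix V V ℝ)
    (hP : ∀ u, ∑ v, P u v = 1) (t : ℕ) (ht : 0 < t) (x u : V) :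
    auxE P x t (fun p => auxL p u) = green P t x u := by
  obtain ⟨n, rfl⟩ : ∃ n, t = n + 1 := ⟨t - 1, by omega⟩
  unfold auxL green
  rw [auxE_sum]
  refine Finset.sum_congr rfl fun i hi => ?_
  exact auxE_single P hP n x i (by simp at hi; omega) u

lemma auxE_LL {V : Type} [Fintype V] [Nonempty V] (P : Matrix V V ℝ)
    (hP : ∀ u, ∑ v, P u v = 1) (hP0 : ∀ n u v, 0 ≤ (P ^ n) u v) (t : ℕ) (ht : 0 < t) (x u v : V) :
    0 ≤ auxE P x t (fun p => auxL p u * auxL p v) ∧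
    auxE P x t (fun p => auxL p u * auxL p v)
      ≤ green P t x u * green P t u v + green P t x v * green P t v u := by
  obtain ⟨n, rfl⟩ : ∃ n, t = n + 1 := ⟨t - 1, by omega⟩
  have h1 : auxE P x (n + 1) (fun p => auxL p u * auxL p v)
    = ∑ i ∈ range (n + 1), ∑ k ∈ range (n + 1), auxE P x (n + 1)
        (fun p => (if traj p i = u then 1 else 0) * (if traj p k = v then 1 else 0)) := by
    unfold auxL
    simp_rw [sum_mul_sum]
    rw [auxE_sum]
    refine Finset.sum_congr rfl fun i _ => ?_
    rw [auxE_sum]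
  have h2 : ∀ i ∈ range (n + 1), ∀ k ∈ range (n + 1), auxE P x (n + 1)
        (fun p => (if traj p i = u then 1 else 0) * (if traj p k = v then 1 else 0))
      = if i ≤ k then (P ^ i) x u * (P ^ (k - i)) u v else (P ^ k) x v * (P ^ (i - k)) v u := by
    intro i hi k hk
    simp at hi hk
    split_ifs with hik
    · exact auxE_pair P hP n x i k hik (by omega) u v
    · rw [← auxE_pair P hP n x k i (by omega) (by omega) v u]
      exact auxE_congr _ _ _ _ _ fun p => mul_comm _ _
  have h3 : auxE P x (n + 1) (fun p => auxL p u * auxL p v)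
    = ∑ i ∈ range (n + 1), ∑ k ∈ range (n + 1),
      if i ≤ k then (P ^ i) x u * (P ^ (k - i)) u v else (P ^ k) x v * (P ^ (i - k)) v u := by
    rw [h1]
    exact Finset.sum_congr rfl fun i hi => Finset.sum_congr rfl fun k hk => h2 i hi k hk
  have shift : ∀ (a b : V) (i : ℕ),
      (∑ k ∈ range (n + 1), if i ≤ k then (P ^ (k - i)) a b else 0) ≤ green P (n + 1) a b := by
    intro a b i
    rw [← Finset.sum_filter]
    unfold green
    have : ∑ k ∈ (range (n + 1)).filter (fun k => i ≤ k), (P ^ (k - i)) a b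
      = ∑ k ∈ ((range (n + 1)).filter (fun k => i ≤ k)).image (fun k => k - i), (P ^ k) a b := by
      rw [Finset.sum_image]
      intro c hc e he hce
      simp at hc he hce
      omega
    rw [this]
    refine Finset.sum_le_sum_of_subset_of_nonneg ?_ fun k _ _ => hP0 _ _ _
    intro k hk
    simp at hk ⊢
    omega
  rw [h3]
  constructor
  · refine Finset.sum_nonneg fun i _ => Finset.sum_nonneg fun k _ => ?_
    split_ifs <;> exact mul_nonneg (hP0 _ _ _) (hP0 _ _ _)
  · have h4 : ∀ i k : ℕ, (if i ≤ k then (P ^ i) x u * (P ^ (k - i)) u v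
        else (P ^ k) x v * (P ^ (i - k)) v u)
        ≤ (P ^ i) x u * (if i ≤ k then (P ^ (k - i)) u v else 0)
          + (P ^ k) x v * (if k ≤ i then (P ^ (i - k)) v u else 0) := by
      intro i k
      have a1 := mul_nonneg (hP0 k x v) (hP0 (i - k) v u)
      by_cases h : i ≤ k
      · rw [if_pos h, if_pos h]
        split_ifs
        · linarith
        · linarith
      · rw [if_neg h, if_neg h, if_pos (by omega)]
        linarith
    refine (Finset.sum_le_sum fun i _ => Finset.sum_le_sum fun k _ => h4 i k).trans ?_
    simp_rw [Finset.sum_add_distrib]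
    refine add_le_add ?_ ?_
    · simp_rw [← mul_sum]
      refine (Finset.sum_le_sum fun i _ =>
        mul_le_mul_of_nonneg_left (shift u v i) (hP0 _ _ _)).trans ?_
      rw [← sum_mul]; rfl
    · rw [Finset.sum_comm]
      simp_rw [← mul_sum]
      refine (Finset.sum_le_sum fun i _ =>
        mul_le_mul_of_nonneg_left (shift v u i) (hP0 _ _ _)).trans ?_
      rw [← sum_mul]; rfl

lemma aux_E2_mean {V : Type} [Fintype V] [Nonempty V] (G : SimpleGraph V)
    (hd : ∀ u, 0 < G.degree u) (t : ℕ) (ht : 0 < t) (x : V) :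
    E2 (lazyP G) x x t (fun p q => wInter G p q) = auxM1 G t x := by
  unfold E2 auxM1
  simp_rw [aux_wInter, mul_sum]
  have h1 : ∀ p : Fin t → V, ∑ q : Fin t → V, ∑ u, pathWeight (lazyP G) x t p *
      pathWeight (lazyP G) x t q * (auxL p u * auxL q u * (1 / (G.degree u : ℝ)))
      = ∑ u, pathWeight (lazyP G) x t p * auxL p u * (green (lazyP G) t x u) / G.degree u := by
    intro p
    rw [Finset.sum_comm]
    refine Finset.sum_congr rfl fun u _ => ?_
    rw [← auxE_L (lazyP G) (aux_row G hd) t ht x u]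
    unfold auxE
    rw [mul_sum, sum_div]
    exact Finset.sum_congr rfl fun q _ => by ring
  simp_rw [h1]
  rw [Finset.sum_comm]
  refine Finset.sum_congr rfl fun u _ => ?_
  rw [← sum_div, ← sum_mul, sq]
  congr 2
  exact auxE_L (lazyP G) (aux_row G hd) t ht x u

lemma aux_E2_sq {V : Type} [Fintype V] [Nonempty V] (G : SimpleGraph V)
    (hd : ∀ u, 0 < G.degree u) (t : ℕ) (ht : 0 < t) (x : V) (M : ℝ)
    (hM : ∀ u, auxM1 G t u ≤ M) :
    E2 (lazyP G) x x t (fun p q => wInter G p q ^ 2) ≤ 4 * (auxM1 G t x * M) := by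
  have hg0 : ∀ u v, 0 ≤ green (lazyP G) t u v := fun u v =>
    Finset.sum_nonneg fun i _ => aux_pow_nonneg G i u v
  set B : V → V → ℝ := fun u v => auxE (lazyP G) x t (fun p => auxL p u * auxL p v) with hB
  set g := green (lazyP G) t with hg
  have h1 : E2 (lazyP G) x x t (fun p q => wInter G p q ^ 2)
      = ∑ u, ∑ v, B u v ^ 2 / ((G.degree u : ℝ) * G.degree v) := by
    unfold E2
    have e1 : ∀ p q : Fin t → V, pathWeight (lazyP G) x t p *
      pathWeight (lazyP G) x t q * wInter G p q ^ 2 = ∑ u, ∑ v,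
        (pathWeight (lazyP G) x t p * (auxL p u * auxL p v)) *
        (pathWeight (lazyP G) x t q * (auxL q u * auxL q v)) /
          ((G.degree u : ℝ) * G.degree v) := by
      intro p q
      rw [aux_wInter, sq, sum_mul_sum, mul_sum]
      refine Finset.sum_congr rfl fun u _ => ?_
      rw [mul_sum]
      refine Finset.sum_congr rfl fun v _ => ?_
      rw [div_eq_mul_inv _ ((G.degree u : ℝ) * G.degree v), mul_inv]
      ring
    simp_rw [e1]
    have e2 : ∀ p : Fin t → V, ∑ q : Fin t → V, ∑ u, ∑ v,
        (pathWeight (lazyP G) x t p * (auxL p u * auxL p v)) *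
        (pathWeight (lazyP G) x t q * (auxL q u * auxL q v)) /
          ((G.degree u : ℝ) * G.degree v)
        = ∑ u, ∑ v, (pathWeight (lazyP G) x t p * (auxL p u * auxL p v)) * B u v /
          ((G.degree u : ℝ) * G.degree v) := by
      intro p
      rw [Finset.sum_comm]
      refine Finset.sum_congr rfl fun u _ => ?_
      rw [Finset.sum_comm]
      refine Finset.sum_congr rfl fun v _ => ?_
      rw [← sum_div, ← mul_sum]
      rfl
    simp_rw [e2]
    rw [Finset.sum_comm]
    refine Finset.sum_congr rfl fun u _ => ?_
    rw [Finset.sum_comm]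
    refine Finset.sum_congr rfl fun v _ => ?_
    rw [← sum_div, ← sum_mul, sq]
    rfl
  rw [h1]
  have h2 : ∀ u v, B u v ^ 2 / ((G.degree u : ℝ) * G.degree v)
      ≤ 2 * (g x u ^ 2 / G.degree u * (g u v ^ 2 / G.degree v))
        + 2 * (g x v ^ 2 / G.degree v * (g v u ^ 2 / G.degree u)) := by
    intro u v
    obtain ⟨b0, b1⟩ := auxE_LL (lazyP G) (aux_row G hd) (aux_pow_nonneg G) t ht x u v
    have b2 : B u v ^ 2 ≤ 2 * (g x u * g u v) ^ 2 + 2 * (g x v * g v u) ^ 2 := by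
      have : B u v ^ 2 ≤ (g x u * g u v + g x v * g v u) ^ 2 := by
        exact pow_le_pow_left₀ b0 b1 2
      nlinarith [sq_nonneg (g x u * g u v - g x v * g v u)]
    calc _ ≤ (2 * (g x u * g u v) ^ 2 + 2 * (g x v * g v u) ^ 2) /
          ((G.degree u : ℝ) * G.degree v) := by gcongr
      _ = _ := by
        have hu : (G.degree u : ℝ) ≠ 0 := by exact_mod_cast (hd u).ne'
        have hv : (G.degree v : ℝ) ≠ 0 := by exact_mod_cast (hd v).ne'
        field_simp
  refine (Finset.sum_le_sum fun u _ => Finset.sum_le_sum fun v _ => h2 u v).trans ?_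
  simp_rw [Finset.sum_add_distrib]
  have h3 : ∑ u, ∑ v, 2 * (g x u ^ 2 / G.degree u * (g u v ^ 2 / G.degree v))
      ≤ 2 * (auxM1 G t x * M) := by
    simp_rw [← mul_sum]
    unfold auxM1
    rw [sum_mul]
    refine mul_le_mul_of_nonneg_left (Finset.sum_le_sum fun u _ => ?_) (by norm_num)
    exact mul_le_mul_of_nonneg_left (hM u) (by positivity)
  have h4 : ∑ u, ∑ v, 2 * (g x v ^ 2 / G.degree v * (g v u ^ 2 / G.degree u))
      ≤ 2 * (auxM1 G t x * M) := by
    rw [Finset.sum_comm]; exact h3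
  linarith

lemma aux_prod_one {Ω : Type} [Fintype Ω] (ω : Ω → ℝ) (h1 : ∑ z, ω z = 1) (K : ℕ) :
    ∑ Z : Fin K → Ω, ∏ k, ω (Z k) = 1 := by
  induction K with
  | zero => simp
  | succ K ih =>
    rw [← (Fin.consEquiv (fun _ => Ω)).sum_comp, Fintype.sum_prod_type]
    simp only [Fin.consEquiv, Equiv.coe_fn_mk, Fin.prod_univ_succ, Fin.cons_zero, Fin.cons_succ]
    simp_rw [← mul_sum, ih, mul_one, h1]

lemma aux_prod_var {Ω : Type} [Fintype Ω] (ω f : Ω → ℝ) (h1 : ∑ z, ω z = 1)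
    (h0 : ∑ z, ω z * f z = 0) (K : ℕ) :
    ∑ Z : Fin K → Ω, (∏ k, ω (Z k)) * (∑ k, f (Z k)) ^ 2 = K * ∑ z, ω z * f z ^ 2 := by
  induction K with
  | zero => simp
  | succ K ih =>
    rw [← (Fin.consEquiv (fun _ => Ω)).sum_comp, Fintype.sum_prod_type]
    simp only [Fin.consEquiv, Equiv.coe_fn_mk, Fin.prod_univ_succ, Fin.sum_univ_succ,
      Fin.cons_zero, Fin.cons_succ]
    have e : ∀ (z : Ω) (Z : Fin K → Ω), ω z * (∏ k, ω (Z k)) * (f z + ∑ k, f (Z k)) ^ 2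
      = ω z * f z ^ 2 * (∏ k, ω (Z k)) + 2 * (ω z * f z) * ((∏ k, ω (Z k)) * ∑ k, f (Z k))
        + ω z * ((∏ k, ω (Z k)) * (∑ k, f (Z k)) ^ 2) := by intros; ring
    simp_rw [e, Finset.sum_add_distrib, ← mul_sum, ih, aux_prod_one ω h1, ← sum_mul, ← mul_sum,
      h0, h1]
    push_cast
    ring

lemma aux_EK {V : Type} [Fintype V] [Nonempty V] (P : Matrix V V ℝ) (x : V) (t K : ℕ)
    (F : (Fin K → Fin t → V) → (Fin K → Fin t → V) → ℝ) :
    EK P x t K F = ∑ Z : Fin K → (Fin t → V) × (Fin t → V),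
      (∏ k, (pathWeight P x t (Z k).1 * pathWeight P x t (Z k).2)) *
        F (fun k => (Z k).1) (fun k => (Z k).2) := by
  unfold EK
  rw [← Fintype.sum_prod_type',
    ← (Equiv.arrowProdEquivProdArrow (Fin K) (fun _ => Fin t → V) (fun _ => Fin t → V)).sum_comp]
  refine Finset.sum_congr rfl fun Z _ => ?_
  simp only [Equiv.arrowProdEquivProdArrow, Equiv.coe_fn_mk, Finset.prod_mul_distrib]

lemma aux_ind (tt m S K R W : ℝ) (ht : 0 < tt) (hW : 0 < W) (hm : m = W / 2) (hK : 0 < K)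
    (hR1 : 1 ≤ R) (hR2 : R ≤ 19 / 12) (hS : 0 ≤ S)
    (h : 1 / 2 < |tt / ((2 / K) * S) / m - 1|) : 1 ≤ 9 * (W / (K * tt) * S - R) ^ 2 := by
  set s := W / (K * tt) * S with hs
  have hs0 : 0 ≤ s := by positivity
  have key : s ≤ 2 / 3 ∨ 2 ≤ s := by
    by_contra hcon
    push Not at hcon
    obtain ⟨c1, c2⟩ := hcon
    have hS' : S ≠ 0 := by
      rintro rfl
      simp [hs] at c1; linarith
    have e : tt / ((2 / K) * S) / m = 1 / s := by
      rw [hs, hm]; field_simp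
    rw [e] at h
    have hsp : 0 < s := by linarith
    have u1 : 1 / s ≤ 3 / 2 := by rw [div_le_iff₀ hsp]; linarith
    have u2 : 1 / 2 ≤ 1 / s := by rw [le_div_iff₀ hsp]; linarith
    have : |1 / s - 1| ≤ 1 / 2 := abs_le.2 ⟨by linarith, by linarith⟩
    linarith
  rcases key with k | k
  · nlinarith
  · nlinarith

end helpers

/-- There is a universal constant `C > 0` such that for every finite
connected graph `G` with `m` edges, minimum degree `d` and relaxation time `t_rel`, every
vertex `x`, every `K ≥ 1` and every `t ≥ 4√3 t_rel^{3/4} √(m/d)`, the estimator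
`m̂_t = t² / ((2/K) ∑_k 𝓘_t^{(k)})` built from `K` independent pairs of lazy random walks of
length `t` started at `x` satisfies `P_x(|m̂_t/m - 1| > 1/2) ≤ C/K`. -/
theorem edge_estimator_general_graphs : ∃ C : ℝ, 0 < C ∧
    ∀ (V : Type) [Fintype V] [Nontrivial V] (G : SimpleGraph V), G.Connected →
      ∀ (x : V) (K t : ℕ), 1 ≤ K →
        4 * Real.sqrt 3 * (relTime (lazyP G) : ℝ) ^ ((3 : ℝ) / 4) *
            Real.sqrt ((numEdges G : ℝ) / (G.minDegree : ℝ)) ≤ (t : ℝ) →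
          EK (lazyP G) x t K (fun X Y =>
              if 1 / 2 <
                  |(t : ℝ) ^ 2 / ((2 / (K : ℝ)) * ∑ k, wInter G (X k) (Y k)) /
                      (numEdges G : ℝ) - 1|
              then 1 else 0) ≤ C / (K : ℝ) := by

  refine ⟨144, by norm_num, ?_⟩
  intro V _ _ G hc x K t hK ht
  have hd : ∀ u, 0 < G.degree u := fun u => hc.preconnected.degree_pos_of_nontrivial u
  have hmin : 0 < G.minDegree := by
    obtain ⟨v, hv⟩ := G.exists_minimal_degree_vertex
    rw [hv]; exact hd v
  have hd0 : (0 : ℝ) < G.minDegree := by exact_mod_cast hmin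
  have hdd : ∀ u, (G.minDegree : ℝ) ≤ G.degree u := fun u => by
    exact_mod_cast G.minDegree_le_degree u
  have hW := auxW_pos G hd x
  have hm : (numEdges G : ℝ) = auxW G / 2 := by
    have := G.sum_degrees_eq_twice_card_edges
    have h2 : auxW G = 2 * (numEdges G : ℝ) := by
      unfold auxW numEdges
      exact_mod_cast this
    linarith
  have hmean := aux_mean G hc hd _ hd0 hdd t
  obtain ⟨hT1, -⟩ := aux_relTime G hd
  rw [hm] at ht ⊢
  set d : ℝ := (G.minDegree : ℝ)
  set T : ℝ := (relTime (lazyP G) : ℝ)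
  set W := auxW G
  have hT0 : 0 < T := by linarith
  have htpos : (0 : ℝ) < t := lt_of_lt_of_le (by positivity) ht
  have htn : 0 < t := by exact_mod_cast htpos
  have hK0 : (0 : ℝ) < K := by exact_mod_cast hK
  -- bound on the error
  have herr : T * (14 * Real.sqrt T * W / d) ≤ 7 / 12 * (t : ℝ) ^ 2 := by
    have h1 : (4 * Real.sqrt 3 * T ^ ((3 : ℝ) / 4) * Real.sqrt (W / 2 / d)) ^ 2 ≤ (t : ℝ) ^ 2 :=
      pow_le_pow_left₀ (by positivity) ht 2
    have h2 : (T ^ ((3 : ℝ) / 4)) ^ 2 = T * Real.sqrt T := by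
      rw [← Real.rpow_natCast, ← Real.rpow_mul hT0.le, Real.sqrt_eq_rpow]
      nth_rewrite 2 [← Real.rpow_one T]
      rw [← Real.rpow_add hT0]
      norm_num
    rw [mul_pow, mul_pow, mul_pow, h2, Real.sq_sqrt (by norm_num), Real.sq_sqrt (by positivity)]
      at h1
    have h3 : T * (14 * Real.sqrt T * W / d)
      = 7 / 12 * (4 ^ 2 * 3 * (T * Real.sqrt T) * (W / 2 / d)) := by ring
    rw [h3]
    linarith
  have hup : ∀ u, auxM1 G t u ≤ 19 / 12 * (t : ℝ) ^ 2 / W := fun u => by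
    rw [le_div_iff₀ hW]
    have := (hmean u).2
    linarith
  set a := auxM1 G t x with ha
  set R := W * a / (t : ℝ) ^ 2 with hR
  have hR1 : 1 ≤ R := by rw [hR, le_div_iff₀ (by positivity)]; linarith [(hmean x).1]
  have hR2 : R ≤ 19 / 12 := by
    rw [hR, div_le_iff₀ (by positivity)]; linarith [(hmean x).2]
  -- probability
  set ω : (Fin t → V) × (Fin t → V) → ℝ := fun z =>
    pathWeight (lazyP G) x t z.1 * pathWeight (lazyP G) x t z.2 with hω
  have hpw0 : ∀ p : Fin t → V, 0 ≤ pathWeight (lazyP G) x t p := fun p =>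
    mul_nonneg (by split_ifs <;> norm_num) (Finset.prod_nonneg fun i _ => aux_nonneg G _ _)
  have hpw1 : ∑ p : Fin t → V, pathWeight (lazyP G) x t p = 1 := by
    obtain ⟨n, hn⟩ : ∃ n, t = n + 1 := ⟨t - 1, by omega⟩
    have := auxE_total (lazyP G) (aux_row G hd) n x
    rw [← hn] at this
    simpa [auxE] using this
  have hω0 : ∀ z, 0 ≤ ω z := fun z => mul_nonneg (hpw0 _) (hpw0 _)
  have hω1 : ∑ z, ω z = 1 := by
    rw [Fintype.sum_prod_type]
    simp only [hω]
    simp_rw [← mul_sum, hpw1, mul_one, hpw1]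
  have hE1 : ∑ z, ω z * wInter G z.1 z.2 = a := by
    rw [Fintype.sum_prod_type, ha, ← aux_E2_mean G hd t htn x]
    rfl
  have hE2 : ∑ z, ω z * wInter G z.1 z.2 ^ 2 ≤ 4 * (a * (19 / 12 * (t : ℝ) ^ 2 / W)) := by
    have := aux_E2_sq G hd t htn x _ hup
    rw [Fintype.sum_prod_type]
    exact this
  have hwi0 : ∀ p q : Fin t → V, 0 ≤ wInter G p q := fun p q => by
    unfold wInter wInterIco
    exact Finset.sum_nonneg fun i _ => Finset.sum_nonneg fun j _ => by split_ifs <;> positivity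
  have hvar := aux_prod_var ω (fun z => wInter G z.1 z.2 - a) hω1 (by
    simp_rw [mul_sub, Finset.sum_sub_distrib, ← sum_mul, hω1, hE1]; ring) K
  have hvar2 : ∑ z, ω z * (wInter G z.1 z.2 - a) ^ 2 ≤ 4 * (a * (19 / 12 * (t : ℝ) ^ 2 / W)) := by
    refine le_trans ?_ hE2
    have e : ∀ z, ω z * (wInter G z.1 z.2 - a) ^ 2
      = ω z * wInter G z.1 z.2 ^ 2 - 2 * a * (ω z * wInter G z.1 z.2) + a ^ 2 * ω z := by
      intro z; ring
    simp_rw [e, Finset.sum_add_distrib, Finset.sum_sub_distrib, ← mul_sum, hE1, hω1]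
    nlinarith [sq_nonneg a]
  rw [aux_EK]
  have hstep : ∀ Z : Fin K → (Fin t → V) × (Fin t → V),
      (∏ k, (pathWeight (lazyP G) x t (Z k).1 * pathWeight (lazyP G) x t (Z k).2)) *
        (if 1 / 2 < |(t : ℝ) ^ 2 / ((2 / (K : ℝ)) * ∑ k, wInter G (Z k).1 (Z k).2) /
                      (W / 2) - 1| then 1 else 0)
      ≤ 9 * (W / (K * (t : ℝ) ^ 2)) ^ 2 *
        ((∏ k, ω (Z k)) * (∑ k, (wInter G (Z k).1 (Z k).2 - a)) ^ 2) := by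
    intro Z
    have hp : 0 ≤ ∏ k, ω (Z k) := Finset.prod_nonneg fun k _ => hω0 _
    have hS : 0 ≤ ∑ k, wInter G (Z k).1 (Z k).2 := Finset.sum_nonneg fun k _ => hwi0 _ _
    have e1 : (∑ k, (wInter G (Z k).1 (Z k).2 - a))
        = (∑ k, wInter G (Z k).1 (Z k).2) - K * a := by
      rw [Finset.sum_sub_distrib]; simp
    have e2 : 9 * (W / (K * (t : ℝ) ^ 2)) ^ 2 *
        ((∏ k, ω (Z k)) * (∑ k, (wInter G (Z k).1 (Z k).2 - a)) ^ 2)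
        = (∏ k, ω (Z k)) *
          (9 * (W / (K * (t : ℝ) ^ 2) * (∑ k, wInter G (Z k).1 (Z k).2) - R) ^ 2) := by
      have : W / (K * (t : ℝ) ^ 2) * (K * a) = R := by
        rw [hR]; field_simp
      rw [e1, ← this]; ring
    rw [e2]
    refine mul_le_mul_of_nonneg_left ?_ hp
    split_ifs with hi
    · exact aux_ind _ _ _ _ _ _ (by positivity) hW rfl hK0 hR1 hR2 hS hi
    · positivity
  refine (Finset.sum_le_sum fun Z _ => hstep Z).trans ?_
  rw [← mul_sum, hvar]
  calc 9 * (W / (K * (t : ℝ) ^ 2)) ^ 2 * (K * ∑ z, ω z * (wInter G z.1 z.2 - a) ^ 2)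
      ≤ 9 * (W / (K * (t : ℝ) ^ 2)) ^ 2 * (K * (4 * (a * (19 / 12 * (t : ℝ) ^ 2 / W)))) := by
        gcongr
    _ = 57 * R / K := by rw [hR]; field_simp; ring
    _ ≤ 144 / K := by
        gcongr
        linarith
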